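/- Suppose the (k,p,q)-differential condition holds and that ι has dense range in B. Then for every closed two-sided ideal I of B (a topologically closed complex linear subspace I ⊆ B with b·x ∈ I and x·b ∈ I for all b ∈ B, x ∈ I), the set ι(A) ∩ I is dense in I; that is, the closure in B of (range ι) ∩ I equals I. -/

import Mathlib

open MeasureTheory FourierTransform Filter Topology

/-- `f` equals `1` on `[-r, r]`, vanishes outside `(-R, R)`, and stays within distance `1`
of the value `1`. -/
structure IsPlateau (f : ℝ → ℂ) (r R : ℝ) : Prop where
  eq_one : ∀ s, |s| ≤ r → f s = 1
  eq_zero : ∀ s, R ≤ |s| → f s = 0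
  norm_le : ∀ s, ‖1 - f s‖ ≤ 1

theorem fourierInv_real_eq (g : ℝ → ℂ) (s : ℝ) :
    𝓕⁻ g s = ∫ t, Complex.exp (((2 * Real.pi * t * s : ℝ) : ℂ) * Complex.I) * g t := by
  rw [Real.fourierInv_eq']
  refine integral_congr_ae (.of_forall fun t => ?_)
  simp [mul_comm, mul_assoc, mul_left_comm]

theorem continuous_fourierInv {g : ℝ → ℂ} (hg : Integrable g) : Continuous (𝓕⁻ g) := by
  have h : (𝓕⁻ g) = fun s =>
      ∫ t, Complex.exp (((2 * Real.pi * t * s : ℝ) : ℂ) * Complex.I) * g t :=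
    funext (fourierInv_real_eq g)
  rw [h]
  refine continuous_of_dominated (bound := fun t => ‖g t‖) (fun s => ?_) (fun s => ?_) hg.norm ?_
  · exact (Continuous.aestronglyMeasurable (by fun_prop)).mul hg.1
  · refine .of_forall fun t => ?_
    rw [norm_mul, Complex.norm_exp_ofReal_mul_I, one_mul]
  · exact .of_forall fun t => by fun_prop

theorem integral_exp_mul_eq_sinc (c : ℝ) :
    ∫ u in (-1 : ℝ)..1, Complex.exp (((c * u : ℝ) : ℂ) * Complex.I) = 2 * (Real.sinc c : ℂ) := by
  rcases eq_or_ne c 0 with rfl | hc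
  · norm_num
  · have h := intervalIntegral.integral_comp_mul_left (a := -1) (b := 1)
      (fun u : ℝ => Complex.exp ((u : ℂ) * Complex.I)) hc
    rw [h, mul_neg, mul_one, integral_exp_mul_I_eq_sinc, Complex.real_smul]
    have : (c : ℂ) ≠ 0 := by exact_mod_cast hc
    push_cast
    field_simp

theorem integrable_sinc_mul {g : ℝ → ℂ} (hg : Integrable g) (δ : ℝ) :
    Integrable fun t => (Real.sinc (2 * Real.pi * δ * t) : ℂ) * g t := by
  refine hg.bdd_mul (c := 1) ?_ (.of_forall fun t => ?_)
  · exact (Complex.continuous_ofReal.comp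
      (Real.continuous_sinc.comp (by fun_prop))).aestronglyMeasurable
  · simpa using Real.abs_sinc_le_one _

/-- Multiplying by a `sinc` on the frequency side is averaging over an interval. -/
theorem fourierInv_sinc_mul {g : ℝ → ℂ} (hg : Integrable g) (δ s : ℝ) :
    𝓕⁻ (fun t => (Real.sinc (2 * Real.pi * δ * t) : ℂ) * g t) s =
      (1 / 2 : ℂ) * ∫ u in (-1 : ℝ)..1, 𝓕⁻ g (s + δ * u) := by
  simp_rw [fourierInv_real_eq]
  rw [intervalIntegral_integral_swap, ← integral_const_mul]
  · refine integral_congr_ae (.of_forall fun t => ?_)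
    have h : ∀ u : ℝ, Complex.exp (((2 * Real.pi * t * (s + δ * u) : ℝ) : ℂ) * Complex.I) * g t =
        (Complex.exp (((2 * Real.pi * t * s : ℝ) : ℂ) * Complex.I) * g t) *
          Complex.exp (((2 * Real.pi * δ * t * u : ℝ) : ℂ) * Complex.I) := by
      intro u
      rw [mul_right_comm _ (g t), ← Complex.exp_add]
      congr 2
      push_cast
      ring
    simp only [h]
    rw [intervalIntegral.integral_const_mul, integral_exp_mul_eq_sinc]
    ring
  · have hprod : Integrable (fun z : ℝ × ℝ => (1 : ℂ) * g z.2)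
        ((volume.restrict (Set.uIoc (-1) 1)).prod volume) := by
      rw [Set.uIoc_of_le (by norm_num)]
      exact Integrable.mul_prod (f := fun _ : ℝ => (1 : ℂ)) (integrable_const _) hg
    simp only [one_mul] at hprod
    refine hprod.bdd_mul (c := 1)
      (f := fun z : ℝ × ℝ =>
        Complex.exp (((2 * Real.pi * z.2 * (s + δ * z.1) : ℝ) : ℂ) * Complex.I))
      (Continuous.aestronglyMeasurable (by fun_prop)) (.of_forall fun z => ?_)
    rw [Complex.norm_exp_ofReal_mul_I]

theorem IsPlateau.average {f : ℝ → ℂ} {r R δ : ℝ} (hf : IsPlateau f r R) (hc : Continuous f)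
    (hδ : 0 ≤ δ) :
    IsPlateau (fun s => (1 / 2 : ℂ) * ∫ u in (-1 : ℝ)..1, f (s + δ * u)) (r - δ) (R + δ) := by
  have hu : ∀ u ∈ Set.uIcc (-1 : ℝ) 1, |δ * u| ≤ δ := by
    intro u hu
    rw [Set.uIcc_of_le (by norm_num)] at hu
    rw [abs_mul, abs_of_nonneg hδ]
    exact mul_le_of_le_one_right hδ (abs_le.2 hu)
  refine ⟨fun s hs => ?_, fun s hs => ?_, fun s => ?_⟩
  · have h : Set.EqOn (fun u => f (s + δ * u)) (fun _ => (1 : ℂ)) (Set.uIcc (-1) 1) :=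
      fun u h => hf.eq_one _ (by linarith [abs_add_le s (δ * u), hu u h])
    rw [intervalIntegral.integral_congr h]
    norm_num
  · have h : Set.EqOn (fun u => f (s + δ * u)) (fun _ => (0 : ℂ)) (Set.uIcc (-1) 1) :=
      fun u h => hf.eq_zero _ (by
        have := abs_sub (s + δ * u) (δ * u)
        rw [add_sub_cancel_right] at this
        linarith [hu u h])
    rw [intervalIntegral.integral_congr h]
    simp
  · have h : (1 : ℂ) - (1 / 2 : ℂ) * ∫ u in (-1 : ℝ)..1, f (s + δ * u) =
        (1 / 2 : ℂ) * ∫ u in (-1 : ℝ)..1, (1 - f (s + δ * u)) := by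
      rw [intervalIntegral.integral_sub (by simp)
        (Continuous.intervalIntegrable (by fun_prop) _ _), intervalIntegral.integral_const,
        Complex.real_smul]
      push_cast
      ring
    have hb := intervalIntegral.norm_integral_le_of_norm_le_const (a := -1) (b := 1) (C := 1)
      (f := fun u => 1 - f (s + δ * u)) (fun u _ => hf.norm_le _)
    rw [h, norm_mul]
    norm_num at hb ⊢
    linarith

theorem IsPlateau.fourierInv_sinc_mul {g : ℝ → ℂ} {r R δ : ℝ} (hg : Integrable g)
    (h : IsPlateau (𝓕⁻ g) r R) (hδ : 0 ≤ δ) :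
    IsPlateau (𝓕⁻ fun t => (Real.sinc (2 * Real.pi * δ * t) : ℂ) * g t) (r - δ) (R + δ) := by
  rw [show (𝓕⁻ fun t => (Real.sinc (2 * Real.pi * δ * t) : ℂ) * g t) = _ from
    funext (_root_.fourierInv_sinc_mul hg δ)]
  exact h.average (continuous_fourierInv hg) hδ

theorem isPlateau_fourierInv_prod_sinc {g : ℝ → ℂ} {r R : ℝ} (hg : Integrable g)
    (h : IsPlateau (𝓕⁻ g) r R) {δ : ℕ → ℝ} (hδ : ∀ j, 0 ≤ δ j) (N : ℕ) :
    Integrable (fun t =>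
        ((∏ j ∈ Finset.range N, Real.sinc (2 * Real.pi * δ j * t) ^ 2 : ℝ) : ℂ) * g t) ∧
      IsPlateau (𝓕⁻ fun t =>
          ((∏ j ∈ Finset.range N, Real.sinc (2 * Real.pi * δ j * t) ^ 2 : ℝ) : ℂ) * g t)
        (r - 2 * ∑ j ∈ Finset.range N, δ j) (R + 2 * ∑ j ∈ Finset.range N, δ j) := by
  induction N with
  | zero => simpa using ⟨hg, h⟩
  | succ N ih =>
    obtain ⟨hi, hp⟩ := ih
    have hi' := integrable_sinc_mul (integrable_sinc_mul hi (δ N)) (δ N)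
    have hp' := (hp.fourierInv_sinc_mul hi (hδ N)).fourierInv_sinc_mul
      (integrable_sinc_mul hi (δ N)) (hδ N)
    have e : (fun t => (Real.sinc (2 * Real.pi * δ N * t) : ℂ) *
        ((Real.sinc (2 * Real.pi * δ N * t) : ℂ) *
          (((∏ j ∈ Finset.range N, Real.sinc (2 * Real.pi * δ j * t) ^ 2 : ℝ) : ℂ) * g t))) =
        fun t => ((∏ j ∈ Finset.range (N + 1), Real.sinc (2 * Real.pi * δ j * t) ^ 2 : ℝ) : ℂ)
          * g t := by
      funext t
      rw [Finset.prod_range_succ]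
      push_cast
      ring
    rw [e] at hi' hp'
    refine ⟨hi', ?_⟩
    rw [Finset.sum_range_succ]
    convert hp' using 1 <;> ring

/-- Infinitely many averagings, whose total width is at most `S`, in the limit. -/
theorem exists_isPlateau_fourierInv_of_prod_sinc {g : ℝ → ℂ} {r R S : ℝ} (hg : Integrable g)
    (h : IsPlateau (𝓕⁻ g) r R) {δ : ℕ → ℝ} (hδ : ∀ j, 0 ≤ δ j)
    (hS : ∀ N, 2 * ∑ j ∈ Finset.range N, δ j ≤ S) :
    ∃ G : ℝ → ℂ, AEStronglyMeasurable G ∧ IsPlateau (𝓕⁻ G) (r - S) (R + S) ∧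
      ∀ t N, ‖G t‖ ≤ (∏ j ∈ Finset.range N, Real.sinc (2 * Real.pi * δ j * t) ^ 2) * ‖g t‖ := by
  set P : ℕ → ℝ → ℝ := fun N t => ∏ j ∈ Finset.range N, Real.sinc (2 * Real.pi * δ j * t) ^ 2
    with hP
  have hP0 : ∀ N t, 0 ≤ P N t := fun N t => Finset.prod_nonneg fun _ _ => sq_nonneg _
  have hanti : ∀ t, Antitone fun N => P N t := by
    refine fun t => antitone_nat_of_succ_le fun N => ?_
    simp only [hP, Finset.prod_range_succ]
    refine mul_le_of_le_one_right (hP0 N t) ?_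
    rw [sq_le_one_iff_abs_le_one]
    exact Real.abs_sinc_le_one _
  have hbdd : ∀ t, BddBelow (Set.range fun N => P N t) :=
    fun t => ⟨0, by rintro _ ⟨N, rfl⟩; exact hP0 N t⟩
  have hlim : ∀ t, Tendsto (fun N => ((P N t : ℝ) : ℂ) * g t) atTop
      (𝓝 (((⨅ N, P N t : ℝ) : ℂ) * g t)) := fun t =>
    ((Complex.continuous_ofReal.tendsto _).comp
      (tendsto_atTop_ciInf (hanti t) (hbdd t))).mul_const _
  have hN := isPlateau_fourierInv_prod_sinc hg h hδ
  refine ⟨fun t => ((⨅ N, P N t : ℝ) : ℂ) * g t,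
    aestronglyMeasurable_of_tendsto_ae atTop (fun N => (hN N).1.1) (.of_forall hlim), ?_, ?_⟩
  · have hle : ∀ N t, ‖((P N t : ℝ) : ℂ) * g t‖ ≤ ‖g t‖ := by
      intro N t
      rw [norm_mul, Complex.norm_real, Real.norm_of_nonneg (hP0 N t)]
      refine mul_le_of_le_one_left (norm_nonneg _) ?_
      simpa [hP] using hanti t (Nat.zero_le N)
    have hconv : ∀ s, Tendsto (fun N => 𝓕⁻ (fun t => ((P N t : ℝ) : ℂ) * g t) s) atTop
        (𝓝 (𝓕⁻ (fun t => ((⨅ N, P N t : ℝ) : ℂ) * g t) s)) := by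
      intro s
      simp_rw [fourierInv_real_eq]
      refine tendsto_integral_of_dominated_convergence (fun t => ‖g t‖) (fun N => ?_) hg.norm
        (fun N => .of_forall fun t => ?_) (.of_forall fun t => (hlim t).const_mul _)
      · exact (Continuous.aestronglyMeasurable (by fun_prop)).mul (hN N).1.1
      · rw [norm_mul, Complex.norm_exp_ofReal_mul_I, one_mul]
        exact hle N t
    refine ⟨fun s hs => ?_, fun s hs => ?_, fun s => ?_⟩
    · exact tendsto_nhds_unique (hconv s) (tendsto_const_nhds.congr fun N =>
        ((hN N).2.eq_one s (by linarith [hS N])).symm)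
    · exact tendsto_nhds_unique (hconv s) (tendsto_const_nhds.congr fun N =>
        ((hN N).2.eq_zero s (by linarith [hS N])).symm)
    · exact le_of_tendsto ((tendsto_const_nhds.sub (hconv s)).norm)
        (.of_forall fun N => (hN N).2.norm_le s)
  · intro t N
    rw [norm_mul, Complex.norm_real, Real.norm_of_nonneg (Real.iInf_nonneg fun N => hP0 N t)]
    exact mul_le_mul_of_nonneg_right (ciInf_le (hbdd t) N) (norm_nonneg _)

theorem exists_isPlateau_fourierInv {ε : ℝ} (hε : 0 < ε) :
    ∃ g : ℝ → ℂ, Integrable g ∧ IsPlateau (𝓕⁻ g) ε (2 * ε) := by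
  let φ : ContDiffBump (0 : ℝ) := ⟨ε, 2 * ε, hε, by linarith⟩
  have hsupp : HasCompactSupport fun s : ℝ => ((φ s : ℝ) : ℂ) :=
    φ.hasCompactSupport.comp_left Complex.ofReal_zero
  have hsmooth : ContDiff ℝ (⊤ : ℕ∞) fun s : ℝ => ((φ s : ℝ) : ℂ) :=
    Complex.ofRealCLM.contDiff.comp φ.contDiff
  let ψ := hsupp.toSchwartzMap hsmooth
  have hinv : 𝓕⁻ (𝓕 (ψ : ℝ → ℂ)) = ψ := by
    refine ψ.continuous.fourierInv_fourier_eq ψ.integrable ?_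
    rw [← SchwartzMap.fourier_coe]
    exact (𝓕 ψ).integrable
  refine ⟨𝓕 (ψ : ℝ → ℂ), ?_, ?_⟩
  · rw [← SchwartzMap.fourier_coe]
    exact (𝓕 ψ).integrable
  · rw [hinv]
    have hval : ∀ s, ψ s = ((φ s : ℝ) : ℂ) := fun s => rfl
    refine ⟨fun s hs => ?_, fun s hs => ?_, fun s => ?_⟩
    · rw [hval, φ.one_of_mem_closedBall (by simpa [φ] using hs), Complex.ofReal_one]
    · rw [hval, φ.zero_of_le_dist (by simpa [φ] using hs), Complex.ofReal_zero]
    · rw [hval, ← Complex.ofReal_one, ← Complex.ofReal_sub, Complex.norm_real, Real.norm_eq_abs,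
        abs_le]
      constructor <;> linarith [φ.nonneg (x := s), φ.le_one (x := s)]

theorem Real.abs_sinc_le_inv_abs {x : ℝ} (hx : x ≠ 0) : |Real.sinc x| ≤ |x|⁻¹ := by
  rw [Real.sinc_of_ne_zero hx, abs_div, div_eq_mul_inv]
  exact mul_le_of_le_one_left (by positivity) (Real.abs_sin_le_one x)

theorem exists_forall_exp_sub_rpow_le {α β κ D : ℝ} (hα : 0 < α) (hαβ : α < β) (hκ : 0 < κ)
    (hD : 0 ≤ D) :
    ∃ K, 0 ≤ K ∧ ∀ T : ℝ, 0 ≤ T → Real.exp (1 - κ * T ^ β) ≤ K * Real.exp (-(D * T ^ α)) := by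
  set T₀ : ℝ := (D / κ) ^ (β - α)⁻¹ with hT₀
  have hT₀0 : 0 ≤ T₀ := by positivity
  refine ⟨Real.exp (1 + D * T₀ ^ α), by positivity, fun T hT => ?_⟩
  rw [← Real.exp_add, Real.exp_le_exp]
  rcases le_total T T₀ with h | h
  · have h1 : T ^ α ≤ T₀ ^ α := Real.rpow_le_rpow hT h hα.le
    have h2 : 0 ≤ κ * T ^ β := by positivity
    nlinarith
  · have h1 : D / κ ≤ T ^ (β - α) := by
      have := Real.rpow_le_rpow hT₀0 h (sub_pos.2 hαβ).le
      rwa [hT₀, Real.rpow_inv_rpow (by positivity) (sub_pos.2 hαβ).ne'] at this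
    have h2 : T ^ β = T ^ (β - α) * T ^ α := by
      rcases hT.eq_or_lt with rfl | hT'
      · rw [Real.zero_rpow (hα.trans hαβ).ne', Real.zero_rpow hα.ne', mul_zero]
      · rw [← Real.rpow_add hT']
        congr 1
        ring
    have h3 : D ≤ κ * T ^ (β - α) := by
      rw [div_le_iff₀ hκ] at h1
      linarith
    have h4 : 0 ≤ T ^ α := by positivity
    have h5 : 0 ≤ D * T₀ ^ α := by positivity
    rw [h2]
    nlinarith [mul_le_mul_of_nonneg_right h3 h4]

/-- Widths `c * (j + 1) ^ (-s)` with `1 < s < 1 / α` make the product of squared `sinc`s decay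
faster than `exp (-D * |t| ^ α)`. -/
theorem exists_prod_sinc_le {α D S : ℝ} (hα : 0 < α) (hα1 : α < 1) (hD : 0 ≤ D) (hS : 0 < S) :
    ∃ δ : ℕ → ℝ, (∀ j, 0 ≤ δ j) ∧ (∀ N, 2 * ∑ j ∈ Finset.range N, δ j ≤ S) ∧
      ∃ K, 0 ≤ K ∧ ∀ t : ℝ, ∃ N,
        ∏ j ∈ Finset.range N, Real.sinc (2 * Real.pi * δ j * t) ^ 2
          ≤ K * Real.exp (-(D * |t| ^ α)) := by
  obtain ⟨β, hαβ, hβ1⟩ := exists_between hα1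
  have hβ : 0 < β := hα.trans hαβ
  have hs : 1 < β⁻¹ := (one_lt_inv₀ hβ).2 hβ1
  have hsum : Summable fun j : ℕ => ((j : ℝ) + 1) ^ (-β⁻¹) := by
    have := (summable_nat_add_iff 1).2 (Real.summable_nat_rpow.2 (neg_lt_neg hs))
    simpa using this
  set Z : ℝ := ∑' j : ℕ, ((j : ℝ) + 1) ^ (-β⁻¹) with hZ
  have hZ0 : 0 ≤ Z := tsum_nonneg fun j => by positivity
  set c : ℝ := S / (2 * (Z + 1)) with hc
  have hc0 : 0 < c := by positivity
  refine ⟨fun j => c * ((j : ℝ) + 1) ^ (-β⁻¹), fun j => by positivity, fun N => ?_, ?_⟩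
  · rw [← Finset.mul_sum]
    have h1 : ∑ j ∈ Finset.range N, ((j : ℝ) + 1) ^ (-β⁻¹) ≤ Z :=
      hsum.sum_le_tsum _ fun j _ => by positivity
    have h2 : 2 * (c * (Z + 1)) = S := by
      rw [hc]
      field_simp
    nlinarith
  · set m : ℝ := 2 * Real.pi * c / Real.exp 1 with hm
    have hm0 : 0 < m := by positivity
    obtain ⟨K, hK0, hK⟩ := exists_forall_exp_sub_rpow_le hα hαβ (Real.rpow_pos_of_pos hm0 β) hD
    refine ⟨K, hK0, fun t => ?_⟩
    refine ⟨⌊(m * |t|) ^ β⌋₊, le_trans ?_ (hK |t| (abs_nonneg t))⟩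
    have hfac : ∀ j ∈ Finset.range ⌊(m * |t|) ^ β⌋₊,
        Real.sinc (2 * Real.pi * (c * ((j : ℝ) + 1) ^ (-β⁻¹)) * t) ^ 2 ≤ Real.exp (-1) := by
      intro j hj
      have hj1 : ((j : ℝ) + 1) ≤ (m * |t|) ^ β := by
        have : ((j + 1 : ℕ) : ℝ) ≤ (m * |t|) ^ β :=
          (Nat.le_floor_iff (by positivity)).1 (Finset.mem_range.1 hj)
        exact_mod_cast this
      have hj2 : ((j : ℝ) + 1) ^ β⁻¹ ≤ m * |t| := by
        have := Real.rpow_le_rpow (by positivity) hj1 (inv_pos.2 hβ).le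
        rwa [Real.rpow_rpow_inv (by positivity) hβ.ne'] at this
      set x : ℝ := 2 * Real.pi * (c * ((j : ℝ) + 1) ^ (-β⁻¹)) * t with hx
      have hpow : 0 < ((j : ℝ) + 1) ^ β⁻¹ := by positivity
      have hxe : Real.exp 1 ≤ |x| := by
        rw [hx, abs_mul, abs_of_pos (by positivity), Real.rpow_neg (by positivity)]
        rw [hm, div_mul_eq_mul_div, le_div_iff₀ (Real.exp_pos 1)] at hj2
        have : 2 * Real.pi * (c * (((j : ℝ) + 1) ^ β⁻¹)⁻¹) * |t| =
            2 * Real.pi * c * |t| / ((j : ℝ) + 1) ^ β⁻¹ := by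
          field_simp
        rw [this, le_div_iff₀ hpow]
        linarith
      have h1 : |Real.sinc x| ≤ Real.exp (-1) := by
        refine (Real.abs_sinc_le_inv_abs (abs_pos.1 ((Real.exp_pos 1).trans_le hxe))).trans ?_
        rw [Real.exp_neg]
        exact inv_anti₀ (Real.exp_pos 1) hxe
      rw [← sq_abs, sq]
      exact (mul_le_of_le_one_left (abs_nonneg _) (Real.abs_sinc_le_one x)).trans h1
    refine (Finset.prod_le_prod (fun _ _ => sq_nonneg _) hfac).trans ?_
    rw [Finset.prod_const, Finset.card_range, ← Real.exp_nat_mul, Real.exp_le_exp,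
      ← Real.mul_rpow hm0.le (abs_nonneg t)]
    linarith [Nat.lt_floor_add_one ((m * |t|) ^ β)]

/-- Plateau functions whose Fourier transform is integrable against `exp (D * |t| ^ α)`. -/
theorem exists_isPlateau_integrable_exp {α D ε : ℝ} (hα : 0 < α) (hα1 : α < 1) (hD : 0 ≤ D)
    (hε : 0 < ε) :
    ∃ G : ℝ → ℂ, Integrable G ∧ IsPlateau (𝓕⁻ G) ε (5 * ε) ∧
      Integrable fun t => Real.exp (D * |t| ^ α) * ‖G t‖ := by
  obtain ⟨g, hg, hplat⟩ := exists_isPlateau_fourierInv (ε := 2 * ε) (by positivity)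
  obtain ⟨δ, hδ, hS, K, hK0, hK⟩ := exists_prod_sinc_le hα hα1 hD hε
  obtain ⟨G, hGm, hGp, hGle⟩ := exists_isPlateau_fourierInv_of_prod_sinc hg hplat hδ hS
  refine ⟨G, hg.mono hGm (.of_forall fun t => by simpa using hGle t 0), ?_, ?_⟩
  · convert hGp using 1 <;> ring
  · refine (hg.norm.const_mul K).mono' ?_ (.of_forall fun t => ?_)
    · refine (Continuous.aestronglyMeasurable ?_).mul hGm.norm
      exact Real.continuous_exp.comp
        (continuous_const.mul (continuous_abs.rpow_const fun _ => Or.inr hα.le))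
    · obtain ⟨N, hN⟩ := hK t
      rw [Real.norm_of_nonneg (by positivity)]
      calc Real.exp (D * |t| ^ α) * ‖G t‖
          ≤ Real.exp (D * |t| ^ α) * ((K * Real.exp (-(D * |t| ^ α))) * ‖g t‖) := by
            gcongr
            exact (hGle t N).trans (mul_le_mul_of_nonneg_right hN (norm_nonneg _))
        _ = K * ‖g t‖ * (Real.exp (D * |t| ^ α) * Real.exp (-(D * |t| ^ α))) := by ring
        _ = K * ‖g t‖ := by rw [← Real.exp_add]; simp

/-- A functional inequality `M (k t) ≤ C (M t) ^ p` with `p < k` forces subexponential growth. -/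
theorem exists_subexponential_bound {M : ℝ → ℝ} (hM : Continuous M) (hM0 : ∀ t, 0 ≤ M t)
    {k : ℕ} (hk : 2 ≤ k) {p C : ℝ} (hp : 0 < p) (hpk : p < k) (hC : 0 < C)
    (h : ∀ t, M (k * t) ≤ C * M t ^ p) :
    ∃ α D : ℝ, 0 < α ∧ α < 1 ∧ 0 ≤ D ∧
      ∀ t, M t ≤ Real.exp D * Real.exp (D * |t| ^ α) := by
  have hk1 : (1 : ℝ) < k := by exact_mod_cast hk
  have hk0 : (0 : ℝ) < k := by linarith
  have hlogk : 0 < Real.log k := Real.log_pos hk1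
  have hα' : max 0 (Real.log p / Real.log k) < 1 :=
    max_lt one_pos ((div_lt_one hlogk).2 (Real.log_lt_log hp hpk))
  obtain ⟨α, hα, hα1⟩ := exists_between hα'
  have hα0 : 0 < α := (le_max_left _ _).trans_lt hα
  have hkα : p < (k : ℝ) ^ α := by
    have := (le_max_right _ _).trans_lt hα
    rw [div_lt_iff₀ hlogk] at this
    rw [Real.rpow_def_of_pos hk0, ← Real.log_lt_iff_lt_exp hp]
    linarith
  obtain ⟨b, hb⟩ := (isCompact_Icc (a := -(k : ℝ)) (b := k)).bddAbove_image hM.continuousOn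
  have hbM : ∀ t : ℝ, |t| ≤ k → M t ≤ b := fun t ht => hb ⟨t, abs_le.1 ht, rfl⟩
  set D : ℝ := max (max b 0) (Real.log C / ((k : ℝ) ^ α - p)) with hD
  have hD0 : 0 ≤ D := (le_max_right _ _).trans (le_max_left _ _)
  have hDC : Real.log C ≤ D * ((k : ℝ) ^ α - p) :=
    (div_le_iff₀ (sub_pos.2 hkα)).1 (le_max_right _ _)
  have hsmall : ∀ t : ℝ, |t| ≤ k → M t ≤ Real.exp D := fun t ht =>
    calc M t ≤ D := (hbM t ht).trans ((le_max_left _ _).trans (le_max_left _ _))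
      _ ≤ Real.exp D := by linarith [Real.add_one_le_exp D]
  have key : ∀ n : ℕ, ∀ t, 1 ≤ |t| → |t| ≤ (k : ℝ) ^ n → M t ≤ Real.exp (D * |t| ^ α) := by
    intro n
    induction n with
    | zero =>
      intro t h1 h2
      rw [pow_zero] at h2
      rw [le_antisymm h2 h1, Real.one_rpow, mul_one]
      exact hsmall t (h2.trans hk1.le)
    | succ n ih =>
      intro t h1 h2
      rcases le_total |t| k with hle | hle
      · refine (hsmall t hle).trans (Real.exp_le_exp.2 ?_)
        exact le_mul_of_one_le_right hD0 (Real.one_le_rpow h1 hα0.le)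
      · have habs : |t / k| = |t| / k := by rw [abs_div, abs_of_pos hk0]
        have h3 : 1 ≤ |t / k| := by rwa [habs, one_le_div hk0]
        have h4 : |t / k| ≤ (k : ℝ) ^ n := by
          rw [habs, div_le_iff₀ hk0, ← pow_succ]
          exact h2
        have h5 := h (t / k)
        rw [mul_div_cancel₀ _ hk0.ne'] at h5
        have h6 : |t| ^ α = (k : ℝ) ^ α * |t / k| ^ α := by
          rw [← Real.mul_rpow hk0.le (abs_nonneg _), habs, mul_div_cancel₀ _ hk0.ne']
        have h7 : 1 ≤ |t / k| ^ α := Real.one_le_rpow h3 hα0.le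
        calc M t ≤ C * M (t / k) ^ p := h5
          _ ≤ C * Real.exp (D * |t / k| ^ α) ^ p := by
              gcongr
              · exact hM0 _
              · exact ih _ h3 h4
          _ = Real.exp (Real.log C + D * |t / k| ^ α * p) := by
              rw [Real.exp_add, Real.exp_log hC, Real.exp_mul (D * |t / k| ^ α)]
          _ ≤ Real.exp (D * |t| ^ α) := by
              rw [Real.exp_le_exp, h6]
              have h8 : 0 ≤ D * ((k : ℝ) ^ α - p) := mul_nonneg hD0 (sub_pos.2 hkα).le
              nlinarith [mul_le_mul_of_nonneg_left h7 h8]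
  refine ⟨α, D, hα0, hα1, hD0, fun t => ?_⟩
  have hexp : 1 ≤ Real.exp (D * |t| ^ α) := Real.one_le_exp (by positivity)
  rcases le_total |t| 1 with ht | ht
  · exact (hsmall t (ht.trans hk1.le)).trans (le_mul_of_one_le_right (Real.exp_pos D).le hexp)
  · obtain ⟨n, hn⟩ := pow_unbounded_of_one_lt |t| hk1
    exact (key n t ht hn.le).trans
      (le_mul_of_one_le_left (by linarith) (Real.one_le_exp hD0))

theorem pow_sub_pow_mem {B : Type*} [Ring B] [Module ℂ B] {I : Submodule ℂ B}
    (hI : ∀ b x : B, x ∈ I → b * x ∈ I ∧ x * b ∈ I) {x z : B} (h : x - z ∈ I) (n : ℕ) :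
    x ^ n - z ^ n ∈ I := by
  induction n with
  | zero => simp
  | succ n ih =>
    have e : x ^ (n + 1) - z ^ (n + 1) = x * (x ^ n - z ^ n) + (x - z) * z ^ n := by
      rw [pow_succ', pow_succ']
      noncomm_ring
    rw [e]
    exact I.add_mem (hI _ _ ih).1 (hI _ _ h).2

/-- If `x` is selfadjoint and at distance less than `ε` from the closed ideal `I`, then functions
vanishing on `[-ε, ε]` map `x` into `I`. -/
theorem cfc_mem_of_norm_sub_lt {B : Type*} [CStarAlgebra B] {I : Submodule ℂ B}
    (hIc : IsClosed (I : Set B)) (hI : ∀ b x : B, x ∈ I → b * x ∈ I ∧ x * b ∈ I)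
    {x y : B} (hx : IsSelfAdjoint x) (hy : y ∈ I) {ε : ℝ} (hxy : ‖x - y‖ < ε)
    {h : ℝ → ℂ} (hc : Continuous h) (hle : ∀ s, ‖h s‖ ≤ 1) (h0 : ∀ s, |s| ≤ ε → h s = 0) :
    cfc (fun z : ℂ => h z.re) x ∈ I := by
  have hε : 0 < ε := (norm_nonneg _).trans_lt hxy
  have hxn : IsStarNormal x := hx.isStarNormal
  have hmax : ∀ s : ℝ, 0 < max (s ^ 2) (ε ^ 2) := fun s => lt_max_of_lt_right (by positivity)
  let u : ℕ → ℂ → ℂ := fun n z => h z.re * (((max (z.re ^ 2) (ε ^ 2) ^ n)⁻¹ : ℝ) : ℂ)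
  have hu : ∀ n, Continuous (u n) := by
    intro n
    refine (hc.comp Complex.continuous_re).mul (Complex.continuous_ofReal.comp ?_)
    exact Continuous.inv₀ (by fun_prop) fun z => (pow_pos (hmax _) n).ne'
  have hfac : ∀ n, cfc (fun z : ℂ => h z.re) x = cfc (u n) x * x ^ (2 * n) := by
    intro n
    rw [← cfc_pow_id (R := ℂ) x (2 * n), ← cfc_mul _ _ x (hu n).continuousOn]
    refine cfc_congr fun z hz => ?_
    have hzr : z = (z.re : ℂ) := hx.mem_spectrum_eq_re hz
    rcases le_total |z.re| ε with hs | hs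
    · simp [u, h0 _ hs]
    · have hsq : ε ^ 2 ≤ z.re ^ 2 := by
        rw [← sq_abs z.re]
        gcongr
      have hne : ((z.re : ℝ) : ℂ) ≠ 0 := by
        have : |z.re| ≠ 0 := (hε.trans_le hs).ne'
        exact_mod_cast abs_ne_zero.1 this
      have e : z ^ (2 * n) = (z.re : ℂ) ^ (2 * n) := congrArg (· ^ (2 * n)) hzr
      simp only [u, e, max_eq_left hsq]
      push_cast
      rw [pow_mul]
      field_simp
  have hun : ∀ n, ‖cfc (u n) x‖ ≤ ((ε ^ 2) ^ n)⁻¹ := by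
    intro n
    refine norm_cfc_le (by positivity) fun z _ => ?_
    have h1 : ‖(((max (z.re ^ 2) (ε ^ 2) ^ n)⁻¹ : ℝ) : ℂ)‖ ≤ ((ε ^ 2) ^ n)⁻¹ := by
      rw [Complex.norm_real, Real.norm_of_nonneg (inv_nonneg.2 (pow_pos (hmax _) n).le)]
      exact inv_anti₀ (by positivity) (pow_le_pow_left₀ (by positivity) (le_max_right _ _) n)
    calc ‖u n z‖ ≤ 1 * ((ε ^ 2) ^ n)⁻¹ := by
          rw [norm_mul]
          exact mul_le_mul (hle _) h1 (norm_nonneg _) zero_le_one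
      _ = _ := one_mul _
  have hlim : Tendsto (fun n : ℕ => cfc (u n) x * (x ^ (2 * n) - (x - y) ^ (2 * n))) atTop
      (𝓝 (cfc (fun z : ℂ => h z.re) x)) := by
    have hr : Tendsto (fun n : ℕ => (‖x - y‖ ^ 2 / ε ^ 2) ^ n) atTop (𝓝 0) := by
      refine tendsto_pow_atTop_nhds_zero_of_lt_one (by positivity) ?_
      rw [div_lt_one (by positivity)]
      gcongr
    refine tendsto_iff_norm_sub_tendsto_zero.2 (squeeze_zero' (.of_forall fun _ => norm_nonneg _)
      ?_ hr)
    filter_upwards [eventually_gt_atTop 0] with n hn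
    rw [hfac n, ← mul_sub, sub_sub_cancel_left, mul_neg, norm_neg]
    calc ‖cfc (u n) x * (x - y) ^ (2 * n)‖
        ≤ ((ε ^ 2) ^ n)⁻¹ * ‖x - y‖ ^ (2 * n) :=
          (norm_mul_le _ _).trans (mul_le_mul (hun n) (norm_pow_le' _ (by omega))
            (norm_nonneg _) (by positivity))
      _ = (‖x - y‖ ^ 2 / ε ^ 2) ^ n := by
          rw [pow_mul, div_pow, div_eq_inv_mul]
  refine hIc.mem_of_tendsto hlim (.of_forall fun n => (hI _ _ (pow_sub_pow_mem hI ?_ _)).1)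
  simpa using hy

theorem exp_smul_eq_cfc {B : Type*} [CStarAlgebra B] {x : B} (hx : IsSelfAdjoint x) (t : ℝ) :
    NormedSpace.exp (((2 * Real.pi * t : ℝ) * Complex.I : ℂ) • x) =
      cfc (fun z : ℂ => Complex.exp (((2 * Real.pi * t * z.re : ℝ) : ℂ) * Complex.I)) x := by
  have hxn : IsStarNormal x := hx.isStarNormal
  set c : ℂ := (2 * Real.pi * t : ℝ) * Complex.I with hc
  have hcn : IsStarNormal (c • x) := by
    rw [← cfc_smul_id (R := ℂ) c x]
    exact cfc_predicate _ _
  rw [← CFC.complex_exp_eq_normedSpace_exp (a := c • x), ← cfc_comp_smul c Complex.exp x]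
  refine cfc_congr fun z hz => ?_
  have e : c * z = c * (z.re : ℂ) := congrArg (c * ·) (hx.mem_spectrum_eq_re hz)
  change Complex.exp (c * z) = _
  rw [e, hc]
  congr 1
  push_cast
  ring

theorem norm_exp_smul_le_one {B : Type*} [CStarAlgebra B] {x : B} (hx : IsSelfAdjoint x) (t : ℝ) :
    ‖NormedSpace.exp (((2 * Real.pi * t : ℝ) * Complex.I : ℂ) • x)‖ ≤ 1 := by
  rw [exp_smul_eq_cfc hx]
  exact norm_cfc_le zero_le_one fun z _ => (Complex.norm_exp_ofReal_mul_I _).le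

theorem integral_smul_exp_eq_cfc {B : Type*} [CStarAlgebra B] {x : B} (hx : IsSelfAdjoint x)
    {G : ℝ → ℂ} (hG : Integrable G) :
    ∫ t, G t • NormedSpace.exp (((2 * Real.pi * t : ℝ) * Complex.I : ℂ) • x) =
      cfc (fun z : ℂ => 𝓕⁻ G z.re) x := by
  have hxn : IsStarNormal x := hx.isStarNormal
  let F : C(ℝ, C(spectrum ℂ x, ℂ)) := ContinuousMap.curry
    ⟨fun w : ℝ × spectrum ℂ x =>
      Complex.exp (((2 * Real.pi * w.1 * (w.2 : ℂ).re : ℝ) : ℂ) * Complex.I), by fun_prop⟩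
  have hF : Integrable fun t => G t • F t := by
    refine hG.norm.mono' (hG.1.smul F.continuous.aestronglyMeasurable) (.of_forall fun t => ?_)
    rw [norm_smul]
    refine mul_le_of_le_one_right (norm_nonneg _) ?_
    exact (ContinuousMap.norm_le _ zero_le_one).2 fun z => (Complex.norm_exp_ofReal_mul_I _).le
  have hcont : Continuous fun z : ℂ => 𝓕⁻ G z.re :=
    (continuous_fourierInv hG).comp Complex.continuous_re
  rw [cfc_apply (fun z : ℂ => 𝓕⁻ G z.re) x hxn hcont.continuousOn]
  have hint : (⟨_, hcont.continuousOn.domRestrict⟩ : C(spectrum ℂ x, ℂ)) = ∫ t, G t • F t := by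
    ext z
    rw [ContinuousMap.integral_apply hF]
    change 𝓕⁻ G (z : ℂ).re = _
    rw [fourierInv_real_eq]
    refine integral_congr_ae (.of_forall fun t => ?_)
    simp [F, mul_comm]
  rw [hint, ← cfcHom_integral x _ hF hxn]
  refine integral_congr_ae (.of_forall fun t => ?_)
  simp only [map_smul]
  rw [exp_smul_eq_cfc hx, cfc_apply _ x hxn (Continuous.continuousOn (by fun_prop))]
  rfl

section Differential

variable {A B : Type*} [NormedRing A] [StarRing A] [NormedAlgebra ℂ A] [CompleteSpace A]
  [CStarAlgebra B] {ι : A →⋆ₙₐ[ℂ] B}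

theorem map_normedSpace_exp (hι : ι 1 = 1) (hcont : Continuous ι) (a : A) :
    ι (NormedSpace.exp a) = NormedSpace.exp (ι a) := by
  let : NormedAlgebra ℚ A := NormedAlgebra.restrictScalars ℚ ℂ A
  let : Algebra ℚ B := Algebra.restrictScalars ℚ ℂ B
  let φ : A →+* B := { toFun := ι, map_one' := hι, map_mul' := map_mul ι, map_zero' := map_zero ι,
                       map_add' := map_add ι }
  exact NormedSpace.map_exp φ hcont a

/-- The one-parameter group generated by an element with selfadjoint image grows
subexponentially. -/
theorem exists_norm_exp_smul_le (hι : ι 1 = 1) (hcont : Continuous ι)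
    {k : ℕ} (hk : 2 ≤ k) {p q : ℝ} (hp : 0 < p) (hq : 0 < q) (hpq : p + q = (k : ℝ))
    {C : ℝ} (hC : 0 < C) (hdiff : ∀ a : A, ‖a ^ k‖ ≤ C * ‖a‖ ^ p * ‖ι a‖ ^ q)
    {a : A} (ha : IsSelfAdjoint (ι a)) :
    ∃ α D : ℝ, 0 < α ∧ α < 1 ∧ 0 ≤ D ∧
      ∀ t : ℝ, ‖NormedSpace.exp (((2 * Real.pi * t : ℝ) * Complex.I : ℂ) • a)‖ ≤
        Real.exp D * Real.exp (D * |t| ^ α) := by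
  let : NormedAlgebra ℚ A := NormedAlgebra.restrictScalars ℚ ℂ A
  refine exists_subexponential_bound
    (M := fun t => ‖NormedSpace.exp (((2 * Real.pi * t : ℝ) * Complex.I : ℂ) • a)‖)
    (NormedSpace.exp_continuous.comp (by fun_prop)).norm (fun t => norm_nonneg _) hk hp
    (by linarith) hC fun t => ?_
  have e : ((2 * Real.pi * (k * t) : ℝ) * Complex.I : ℂ) • a =
      k • (((2 * Real.pi * t : ℝ) * Complex.I : ℂ) • a) := by
    rw [← Nat.cast_smul_eq_nsmul ℂ, smul_smul]
    congr 1
    push_cast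
    ring
  simp only [e, NormedSpace.exp_nsmul]
  refine (hdiff _).trans (mul_le_of_le_one_right (by positivity) ?_)
  refine Real.rpow_le_one (norm_nonneg _) ?_ hq.le
  rw [map_normedSpace_exp hι hcont, map_smul]
  exact norm_exp_smul_le_one ha t

/-- Elements of `A` with selfadjoint image admit a functional calculus by plateau functions. -/
theorem exists_isPlateau_map_eq_cfc (hι : ι 1 = 1) (hcont : Continuous ι)
    {k : ℕ} (hk : 2 ≤ k) {p q : ℝ} (hp : 0 < p) (hq : 0 < q) (hpq : p + q = (k : ℝ))
    {C : ℝ} (hC : 0 < C) (hdiff : ∀ a : A, ‖a ^ k‖ ≤ C * ‖a‖ ^ p * ‖ι a‖ ^ q)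
    {a : A} (ha : IsSelfAdjoint (ι a)) {ε : ℝ} (hε : 0 < ε) :
    ∃ (f : ℝ → ℂ) (τ : A), Continuous f ∧ IsPlateau f ε (5 * ε) ∧
      ι τ = cfc (fun z : ℂ => f z.re) (ι a) := by
  let : NormedAlgebra ℚ A := NormedAlgebra.restrictScalars ℚ ℂ A
  obtain ⟨α, D, hα, hα1, hD, hle⟩ :=
    exists_norm_exp_smul_le hι hcont hk hp hq hpq hC hdiff ha
  obtain ⟨G, hG, hplat, hGe⟩ := exists_isPlateau_integrable_exp hα hα1 hD hε
  let E : ℝ → A := fun t => NormedSpace.exp (((2 * Real.pi * t : ℝ) * Complex.I : ℂ) • a)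
  have hE : Continuous E := NormedSpace.exp_continuous.comp (by fun_prop)
  have hint : Integrable fun t => G t • E t := by
    refine (hGe.const_mul (Real.exp D)).mono' (hG.1.smul hE.aestronglyMeasurable)
      (.of_forall fun t => ?_)
    rw [norm_smul, ← mul_assoc, mul_comm]
    exact mul_le_mul_of_nonneg_right (hle t) (norm_nonneg _)
  let ιL : A →L[ℂ] B := ⟨{ toFun := ι, map_add' := map_add ι, map_smul' := map_smul ι }, hcont⟩
  refine ⟨𝓕⁻ G, ∫ t, G t • E t, continuous_fourierInv hG, hplat, ?_⟩
  rw [← integral_smul_exp_eq_cfc ha hG]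
  refine (ιL.integral_comp_comm hint).symm.trans
    (integral_congr_ae (.of_forall fun t => ?_))
  change ι (G t • E t) = _
  rw [map_smul, map_normedSpace_exp hι hcont, map_smul]

theorem closure_range_inter_eq_of_map_one (hι : ι 1 = 1) (hcont : Continuous ι)
    (hdense : DenseRange ι)
    {k : ℕ} (hk : 2 ≤ k) {p q : ℝ} (hp : 0 < p) (hq : 0 < q) (hpq : p + q = (k : ℝ))
    {C : ℝ} (hC : 0 < C) (hdiff : ∀ a : A, ‖a ^ k‖ ≤ C * ‖a‖ ^ p * ‖ι a‖ ^ q)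
    {I : Submodule ℂ B} (hIc : IsClosed (I : Set B))
    (hI : ∀ b x : B, x ∈ I → b * x ∈ I ∧ x * b ∈ I) :
    closure (Set.range ι ∩ (I : Set B)) = (I : Set B) := by
  refine (closure_minimal Set.inter_subset_right hIc).antisymm fun b hb => ?_
  rw [Metric.mem_closure_iff]
  intro η hη
  set ε : ℝ := η ^ 2 / 80 with hεdef
  have hε : 0 < ε := by positivity
  obtain ⟨a₀, ha₁, ha₂⟩ : ∃ a₀ : A, ‖ι a₀ - b‖ < η / 2 ∧
      ‖star (ι a₀) * ι a₀ - star b * b‖ < ε := by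
    have hopen : IsOpen {v : B | ‖v - b‖ < η / 2 ∧ ‖star v * v - star b * b‖ < ε} :=
      IsOpen.and (isOpen_lt (by fun_prop) (by fun_prop)) (isOpen_lt (by fun_prop) (by fun_prop))
    exact hdense.exists_mem_open hopen ⟨b, by simpa using ⟨by positivity, hε⟩⟩
  have hιa : ι (star a₀ * a₀) = star (ι a₀) * ι a₀ := by rw [map_mul, map_star]
  have hsa : IsSelfAdjoint (ι (star a₀ * a₀)) := hιa ▸ IsSelfAdjoint.star_mul_self _
  obtain ⟨f, τ, hf, hplat, hτ⟩ :=
    exists_isPlateau_map_eq_cfc hι hcont hk hp hq hpq hC hdiff hsa hε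
  have hxn : IsStarNormal (ι (star a₀ * a₀)) := hsa.isStarNormal
  have hf2 : ∀ s, ‖f s‖ ≤ 2 := fun s => by
    have := norm_sub_le (1 : ℂ) (1 - f s)
    rw [sub_sub_cancel, norm_one] at this
    linarith [hplat.norm_le s]
  have hfc : Continuous fun z : ℂ => f z.re := hf.comp Complex.continuous_re
  have hmem : ι (1 - τ) ∈ I := by
    have e : ι (1 - τ) = cfc (fun z : ℂ => 1 - f z.re) (ι (star a₀ * a₀)) := by
      rw [map_sub, hι, hτ, cfc_sub _ _ _ continuousOn_const hfc.continuousOn,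
        cfc_const_one ℂ (ι (star a₀ * a₀))]
    rw [e]
    refine cfc_mem_of_norm_sub_lt (h := fun s => 1 - f s) hIc hI hsa (hI (star b) b hb).1
      (by rwa [hιa]) (by fun_prop) hplat.norm_le fun s hs => ?_
    rw [hplat.eq_one s hs, sub_self]
  refine ⟨ι (a₀ * (1 - τ)), ⟨⟨_, rfl⟩, ?_⟩, ?_⟩
  · rw [map_mul]
    exact (hI _ _ hmem).1
  · have hτ2 : ‖ι τ‖ ≤ 2 := by
      rw [hτ]
      exact norm_cfc_le zero_le_two fun z _ => hf2 _
    have hxτ : ‖ι (star a₀ * a₀) * ι τ‖ ≤ 10 * ε := by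
      have e : ι (star a₀ * a₀) * ι τ = cfc (fun z : ℂ => z * f z.re) (ι (star a₀ * a₀)) := by
        rw [hτ, cfc_mul (fun z : ℂ => z) _ _ continuousOn_id hfc.continuousOn, cfc_id' ℂ _]
      rw [e]
      refine norm_cfc_le (by positivity) fun z hz => ?_
      have hz' : ‖z‖ = |z.re| := by
        conv_lhs => rw [hsa.mem_spectrum_eq_re hz]
        rw [Complex.norm_real, Real.norm_eq_abs]
      rw [norm_mul, hz']
      rcases le_total (5 * ε) |z.re| with h | h
      · rw [hplat.eq_zero _ h, norm_zero, mul_zero]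
        positivity
      · nlinarith [hf2 z.re, norm_nonneg (f z.re), abs_nonneg z.re]
    have hsq : ‖ι a₀ * ι τ‖ * ‖ι a₀ * ι τ‖ ≤ (η / 2) * (η / 2) := by
      rw [← CStarRing.norm_star_mul_self, star_mul, mul_assoc, ← mul_assoc (star (ι a₀)), ← hιa]
      calc ‖star (ι τ) * (ι (star a₀ * a₀) * ι τ)‖ ≤ 2 * (10 * ε) := by
            refine (norm_mul_le _ _).trans (mul_le_mul ?_ hxτ (norm_nonneg _) zero_le_two)
            rwa [norm_star]
        _ = (η / 2) * (η / 2) := by rw [hεdef]; ring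
    have hle : ‖ι a₀ * ι τ‖ ≤ η / 2 := abs_le_of_sq_le_sq' (by nlinarith) (by positivity) |>.2
    have e : b - ι (a₀ * (1 - τ)) = ι a₀ * ι τ - (ι a₀ - b) := by
      rw [map_mul, map_sub, hι, mul_sub, mul_one]
      abel
    rw [dist_eq_norm, e]
    linarith [norm_sub_le (ι a₀ * ι τ) (ι a₀ - b)]

end Differential

/-- A `(k,p,q)`-differential subalgebra with dense range in `B` meets every
closed two-sided ideal `I` of `B` densely: the closure of `(range ι) ∩ I` is `I`. -/
theorem stmt9
    {A B : Type*}
    [NormedRing A] [StarRing A] [NormedAlgebra ℂ A] [CompleteSpace A]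
    [NonUnitalNormedRing B] [StarRing B] [CStarRing B] [NormedSpace ℂ B]
    [IsScalarTower ℂ B B] [SMulCommClass ℂ B B] [StarModule ℂ B] [CompleteSpace B]
    (hstar : Continuous (star : A → A))
    (ι : A →⋆ₙₐ[ℂ] B) (hinj : Function.Injective ι) (hcont : Continuous ι)
    (hdense : DenseRange ι)
    (k : ℕ) (hk : 2 ≤ k) (p q : ℝ) (hp : 0 < p) (hq : 0 < q) (hpq : p + q = (k : ℝ))
    (C : ℝ) (hC : 0 < C)
    (hdiff : ∀ a : A, ‖a ^ k‖ ≤ C * ‖a‖ ^ p * ‖ι a‖ ^ q) :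
    ∀ I : Submodule ℂ B, IsClosed (I : Set B) →
      (∀ (b : B) (x : B), x ∈ I → b * x ∈ I ∧ x * b ∈ I) →
      closure (Set.range ι ∩ (I : Set B)) = (I : Set B) := by
  intro I hIc hI
  have hone : ∀ b : B, ι 1 * b = b := fun b => congrFun (hdense.equalizer
    (g := fun b => ι 1 * b) (h := id) (by fun_prop) continuous_id
    (funext fun a => by simp [← map_mul])) b
  have hone' : ∀ b : B, b * ι 1 = b := fun b => congrFun (hdense.equalizer
    (g := fun b => b * ι 1) (h := id) (by fun_prop) continuous_id
    (funext fun a => by simp [← map_mul])) b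
  let : NormedRing B :=
    { ‹NonUnitalNormedRing B› with
      one := ι 1
      one_mul := hone
      mul_one := hone' }
  let : NormedAlgebra ℂ B :=
    { Algebra.ofModule smul_mul_assoc mul_smul_comm with
      norm_smul_le := norm_smul_le }
  let : CStarAlgebra B := {}
  exact closure_range_inter_eq_of_map_one (ι := ι) rfl hcont hdense hk hp hq hpq hC hdiff hIc hI
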